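/- arXiv:0812.0464 — 3 statements merged into one kernel-verified Lean document; each statement's English description precedes it below -/
import Mathlib

section
/- Given a contraction of (M, d_M) onto (N, d_N) and a small perturbation δ of d_M, the perturbed projection p̃ is a chain map from (M, d_M + δ) to (N, d_N + δ̃): (d_N + δ̃) ∘ p̃ = p̃ ∘ (d_M + δ). -/
namespace BVHPT

variable {R M N : Type*} [CommRing R] [AddCommGroup M] [Module R M]
  [AddCommGroup N] [Module R N]

/-- A differential graded module over `R`: an internally ℤ-graded `R`-module together with
a square-zero differential of degree `+1`. -/
structure DGModule (R M : Type*) [CommRing R] [AddCommGroup M] [Module R M] where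
  grading : ℤ → Submodule R M
  internal : DirectSum.IsInternal grading
  d : M →ₗ[R] M
  d_deg : ∀ i : ℤ, ∀ x ∈ grading i, d x ∈ grading (i + 1)
  d_sq : d ∘ₗ d = 0

/-- A contraction of `(M, d_M)` onto `(N, d_N)`. -/
structure Contraction (𝓜 : DGModule R M) (𝓝 : DGModule R N) where
  ι : N →ₗ[R] M
  p : M →ₗ[R] N
  h : M →ₗ[R] M
  ι_deg : ∀ i : ℤ, ∀ x ∈ 𝓝.grading i, ι x ∈ 𝓜.grading i
  p_deg : ∀ i : ℤ, ∀ x ∈ 𝓜.grading i, p x ∈ 𝓝.grading i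
  h_deg : ∀ i : ℤ, ∀ x ∈ 𝓜.grading i, h x ∈ 𝓜.grading (i - 1)
  chain_ι : 𝓜.d ∘ₗ ι = ι ∘ₗ 𝓝.d
  chain_p : 𝓝.d ∘ₗ p = p ∘ₗ 𝓜.d
  p_ι : p ∘ₗ ι = LinearMap.id
  homotopy : ι ∘ₗ p - LinearMap.id = h ∘ₗ 𝓜.d + 𝓜.d ∘ₗ h
  h_h : h ∘ₗ h = 0
  h_ι : h ∘ₗ ι = 0
  p_h : p ∘ₗ h = 0

/-- A perturbation of the differential `d_M`: a degree `+1` map `δ` with `(d_M + δ)² = 0`. -/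
structure Perturbation (𝓜 : DGModule R M) where
  δ : M →ₗ[R] M
  δ_deg : ∀ i : ℤ, ∀ x ∈ 𝓜.grading i, δ x ∈ 𝓜.grading (i + 1)
  sq : (𝓜.d + δ) ∘ₗ (𝓜.d + δ) = 0

/-- The perturbation `δ` is small w.r.t. the contraction: `(h ∘ δ)ⁿ x = 0` for `n` large
(pointwise). -/
def IsSmall {𝓜 : DGModule R M} {𝓝 : DGModule R N} (C : Contraction 𝓜 𝓝)
    (P : Perturbation 𝓜) : Prop :=
  ∀ x : M, ∃ n : ℕ, ((C.h ∘ₗ P.δ) ^ n) x = 0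

/-- The perturbed maps `ι̃ = Σ (hδ)ⁿ ι`, `p̃ = Σ p (δh)ⁿ`, `h̃ = Σ (hδ)ⁿ h` and
`δ̃ = Σ p δ (hδ)ⁿ ι`, characterized by their (pointwise finite) partial sums. -/
structure PerturbedMaps {𝓜 : DGModule R M} {𝓝 : DGModule R N} (C : Contraction 𝓜 𝓝)
    (P : Perturbation 𝓜) where
  ιT : N →ₗ[R] M
  pT : M →ₗ[R] N
  hT : M →ₗ[R] M
  δT : N →ₗ[R] N
  ιT_spec : ∀ (x : N) (k : ℕ), ((C.h ∘ₗ P.δ) ^ k) (C.ι x) = 0 →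
    ιT x = ∑ n ∈ Finset.range k, ((C.h ∘ₗ P.δ) ^ n) (C.ι x)
  pT_spec : ∀ (x : M) (k : ℕ), ((P.δ ∘ₗ C.h) ^ k) x = 0 →
    pT x = ∑ n ∈ Finset.range k, C.p (((P.δ ∘ₗ C.h) ^ n) x)
  hT_spec : ∀ (x : M) (k : ℕ), ((C.h ∘ₗ P.δ) ^ k) (C.h x) = 0 →
    hT x = ∑ n ∈ Finset.range k, ((C.h ∘ₗ P.δ) ^ n) (C.h x)
  δT_spec : ∀ (x : N) (k : ℕ), ((C.h ∘ₗ P.δ) ^ k) (C.ι x) = 0 →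
    δT x = ∑ n ∈ Finset.range k, C.p (P.δ (((C.h ∘ₗ P.δ) ^ n) (C.ι x)))


/-- If `δ` is small, then `δ ∘ h` is locally nilpotent. -/
theorem IsSmall.exists_pow_comp_eq_zero {𝓜 : DGModule R M} {𝓝 : DGModule R N}
    {C : Contraction 𝓜 𝓝} {P : Perturbation 𝓜} (hsmall : IsSmall C P) (x : M) :
    ∃ n : ℕ, ((P.δ ∘ₗ C.h) ^ n) x = 0 := by
  obtain ⟨n, hn⟩ := hsmall (C.h x)
  refine ⟨n + 1, ?_⟩
  have key : (P.δ ∘ₗ C.h) ^ (n + 1) = P.δ ∘ₗ ((C.h ∘ₗ P.δ) ^ n) ∘ₗ C.h := by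
    clear hn
    induction n with
    | zero => ext; simp
    | succ n ih => ext; rw [pow_succ', ih, pow_succ']; simp
  simp [key, hn]

/-- The recursion `p̃ = p + p̃ ∘ δ ∘ h`. -/
theorem PerturbedMaps.pT_apply {𝓜 : DGModule R M} {𝓝 : DGModule R N}
    {C : Contraction 𝓜 𝓝} {P : Perturbation 𝓜} (hsmall : IsSmall C P)
    (T : PerturbedMaps C P) (x : M) :
    T.pT x = C.p x + T.pT (P.δ (C.h x)) := by
  obtain ⟨n, hn⟩ := hsmall.exists_pow_comp_eq_zero (P.δ (C.h x))
  have hx : ((P.δ ∘ₗ C.h) ^ (n + 1)) x = 0 := by simpa [pow_succ] using hn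
  rw [T.pT_spec x _ hx, T.pT_spec _ n hn, Finset.sum_range_succ']
  simp [pow_succ, add_comm]

/-- The perturbation of `d_N` is `δ̃ = p̃ ∘ δ ∘ ι`. -/
theorem PerturbedMaps.δT_apply {𝓜 : DGModule R M} {𝓝 : DGModule R N}
    {C : Contraction 𝓜 𝓝} {P : Perturbation 𝓜} (hsmall : IsSmall C P)
    (T : PerturbedMaps C P) (x : N) :
    T.δT x = T.pT (P.δ (C.ι x)) := by
  have comm (n : ℕ) (y : M) :
      ((P.δ ∘ₗ C.h) ^ n) (P.δ y) = P.δ (((C.h ∘ₗ P.δ) ^ n) y) := by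
    induction n with
    | zero => simp
    | succ n ih => simp [pow_succ', ih]
  obtain ⟨n, hn⟩ := hsmall (C.ι x)
  rw [T.δT_spec x n hn, T.pT_spec _ n (by rw [comm, hn, map_zero])]
  simp [comm]

/-- Given a contraction of `(M, d_M)` onto `(N, d_N)` and a small perturbation `δ` of `d_M`,
the perturbed projection `p̃` is a chain map from `(M, d_M + δ)` to `(N, d_N + δ̃)`. -/
theorem perturbed_projection_chain_map {𝓜 : DGModule R M} {𝓝 : DGModule R N}
    (C : Contraction 𝓜 𝓝) (P : Perturbation 𝓜)
    (hsmall : IsSmall C P) (T : PerturbedMaps C P) :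
    (𝓝.d + T.δT) ∘ₗ T.pT = T.pT ∘ₗ (𝓜.d + P.δ) := by
  have step (x : M) :
      ((𝓝.d + T.δT) ∘ₗ T.pT - T.pT ∘ₗ (𝓜.d + P.δ)) x =
        ((𝓝.d + T.δT) ∘ₗ T.pT - T.pT ∘ₗ (𝓜.d + P.δ)) ((P.δ ∘ₗ C.h) x) := by
    have hsq := congrArg T.pT (LinearMap.congr_fun P.sq (C.h x))
    have hdd := LinearMap.congr_fun 𝓜.d_sq (C.h x)
    have hp := LinearMap.congr_fun C.chain_p x
    have hhom := congrArg (fun y => T.pT (P.δ y)) (LinearMap.congr_fun C.homotopy x)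
    have hrec := T.pT_apply hsmall x
    have hrecd := T.pT_apply hsmall (𝓜.d x)
    have hδ := T.δT_apply hsmall (C.p x)
    simp only [LinearMap.comp_apply, LinearMap.add_apply, LinearMap.sub_apply,
      LinearMap.zero_apply, LinearMap.id_apply, map_add, map_sub, map_zero] at *
    rw [hdd, map_zero] at hsq
    rw [hrec, map_add, map_add, hδ, hp]
    linear_combination (norm := abel) hhom - hrecd + hsq
  rw [← sub_eq_zero]
  ext x
  have iter (n : ℕ) :
      ((𝓝.d + T.δT) ∘ₗ T.pT - T.pT ∘ₗ (𝓜.d + P.δ)) x =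
        ((𝓝.d + T.δT) ∘ₗ T.pT - T.pT ∘ₗ (𝓜.d + P.δ)) (((P.δ ∘ₗ C.h) ^ n) x) := by
    induction n with
    | zero => simp
    | succ n ih => rw [ih, step, pow_succ']; rfl
  obtain ⟨n, hn⟩ := hsmall.exists_pow_comp_eq_zero x
  rw [iter n, hn, map_zero, LinearMap.zero_apply]

end BVHPT
end

section
/- Given a contraction of (M, d_M) onto (N, d_N) and a small perturbation δ of d_M, the perturbed homotopy relation holds: ι̃ ∘ p̃ − id_M = h̃ ∘ (d_M + δ) + (d_M + δ) ∘ h̃. -/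
namespace BVHPT

variable {R M N : Type*} [CommRing R] [AddCommGroup M] [Module R M]
  [AddCommGroup N] [Module R N]

theorem sum_pow_eq_add_apply_sum (A : M →ₗ[R] M) {x : M} {k : ℕ} (hk : (A ^ k) x = 0) :
    ∑ n ∈ Finset.range k, (A ^ n) x = x + A (∑ n ∈ Finset.range k, (A ^ n) x) := by
  have h := Finset.sum_range_succ' (fun n => (A ^ n) x) k
  rw [Finset.sum_range_succ, hk, add_zero] at h
  simpa [map_sum, pow_succ', add_comm] using h

theorem comp_pow_succ_apply (f g : M →ₗ[R] M) (k : ℕ) (x : M) :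
    ((f ∘ₗ g) ^ (k + 1)) x = f (((g ∘ₗ f) ^ k) (g x)) := by
  induction k with
  | zero => simp
  | succ k ih => rw [pow_succ', Module.End.mul_apply, ih, pow_succ' (g ∘ₗ f)]; simp

namespace PerturbedMaps

variable {𝓜 : DGModule R M} {𝓝 : DGModule R N}
  {C : Contraction 𝓜 𝓝} {P : Perturbation 𝓜}

theorem ιT_apply (hsmall : IsSmall C P) (T : PerturbedMaps C P) (x : N) :
    T.ιT x = C.ι x + C.h (P.δ (T.ιT x)) := by
  obtain ⟨k, hk⟩ := hsmall (C.ι x)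
  rw [T.ιT_spec x k hk]
  exact sum_pow_eq_add_apply_sum (C.h ∘ₗ P.δ) hk

theorem hT_apply (hsmall : IsSmall C P) (T : PerturbedMaps C P) (x : M) :
    T.hT x = C.h x + C.h (P.δ (T.hT x)) := by
  obtain ⟨k, hk⟩ := hsmall (C.h x)
  rw [T.hT_spec x k hk]
  exact sum_pow_eq_add_apply_sum (C.h ∘ₗ P.δ) hk

theorem pT_apply_s3 (hsmall : IsSmall C P) (T : PerturbedMaps C P) (x : M) :
    T.pT x = C.p x + C.p (P.δ (T.hT x)) := by
  obtain ⟨k, hk⟩ := hsmall (C.h x)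
  rw [T.hT_spec x k hk, T.pT_spec x (k + 1) (by rw [comp_pow_succ_apply, hk, map_zero]),
    Finset.sum_range_succ']
  simp only [comp_pow_succ_apply, map_sum, pow_zero, Module.End.one_apply, add_comm]

end PerturbedMaps

theorem IsSmall.eq_zero_of_fixed {𝓜 : DGModule R M} {𝓝 : DGModule R N}
    {C : Contraction 𝓜 𝓝} {P : Perturbation 𝓜} (hsmall : IsSmall C P) {y : M}
    (hy : C.h (P.δ y) = y) : y = 0 := by
  obtain ⟨n, hn⟩ := hsmall y
  rwa [Module.End.pow_apply, Function.iterate_fixed (f := C.h ∘ₗ P.δ) hy n] at hn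

/-- Given a contraction of `(M, d_M)` onto `(N, d_N)` and a small perturbation `δ` of `d_M`,
the perturbed homotopy relation `ι̃ ∘ p̃ − id = h̃ ∘ (d_M + δ) + (d_M + δ) ∘ h̃` holds. -/
theorem perturbed_homotopy_relation {𝓜 : DGModule R M} {𝓝 : DGModule R N}
    (C : Contraction 𝓜 𝓝) (P : Perturbation 𝓜)
    (hsmall : IsSmall C P) (T : PerturbedMaps C P) :
    T.ιT ∘ₗ T.pT - LinearMap.id = T.hT ∘ₗ (𝓜.d + P.δ) + (𝓜.d + P.δ) ∘ₗ T.hT := by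
  ext x
  have hom (y : M) : C.ι (C.p y) - y = C.h (𝓜.d y) + 𝓜.d (C.h y) :=
    LinearMap.congr_fun C.homotopy y
  have hsq : 𝓜.d (P.δ (T.hT x)) + P.δ (𝓜.d (T.hT x)) + P.δ (P.δ (T.hT x)) = 0 := by
    have h := LinearMap.congr_fun P.sq (T.hT x)
    have hd : 𝓜.d (𝓜.d (T.hT x)) = 0 := LinearMap.congr_fun 𝓜.d_sq (T.hT x)
    simp only [LinearMap.comp_apply, LinearMap.add_apply, map_add, LinearMap.zero_apply, hd] at h
    rw [← h]
    abel
  have hι := T.ιT_apply hsmall (T.pT x)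
  have hp := congrArg C.ι (T.pT_apply_s3 hsmall x)
  have hh := T.hT_apply hsmall (𝓜.d x + P.δ x)
  have hdh := congrArg 𝓜.d (T.hT_apply hsmall x)
  have hhsq := congrArg C.h hsq
  have hx := hom x
  have hδ := hom (P.δ (T.hT x))
  simp only [LinearMap.comp_apply, LinearMap.add_apply, LinearMap.sub_apply, LinearMap.id_apply]
  rw [← sub_eq_zero]
  apply hsmall.eq_zero_of_fixed
  simp only [map_add, map_sub, map_zero] at *
  grind

end BVHPT
end

section
/- Let S₂, …, S_n be elements of A₀ (n ≥ 2) with p S_k = 0 for 2 ≤ k ≤ n, and for 2 ≤ k ≤ n + 1 set T_k := (k!/2) Σ_{i+j=k, i,j≥1} {S_i, S_j}. Assume δ₀ S_k = −(1/k!) T_k and p T_k = 0 for 2 ≤ k ≤ n. Then p T_{n+1} is closed for the BRST operator: δ_BRST (p T_{n+1}) = 0. -/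
namespace BVBRST

variable {R A H : Type*} [CommRing R] [AddCommGroup A] [Module R A]
  [AddCommGroup H] [Module R H]

/-- The sign `(−1)^k` applied to an element of an additive group. -/
def gsign {V : Type*} [AddCommGroup V] (k : ℤ) (a : V) : V := if Even k then a else -a

/-- An odd graded Lie structure on a ℤ-graded `R`-module `A`, together with a compatible
square-zero differential `δ₀` of degree `+1` which is a derivation of the bracket. -/
structure OddGradedLieModule (R A : Type*) [CommRing R] [AddCommGroup A] [Module R A] where
  grading : ℤ → Submodule R A
  internal : DirectSum.IsInternal grading
  br : A →ₗ[R] A →ₗ[R] A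
  br_deg : ∀ i j : ℤ, ∀ f ∈ grading i, ∀ g ∈ grading j, br f g ∈ grading (i + j + 1)
  br_comm : ∀ i j : ℤ, ∀ f ∈ grading i, ∀ g ∈ grading j,
    br f g = -gsign ((i + 1) * (j + 1)) (br g f)
  br_jacobi : ∀ i j k : ℤ, ∀ f ∈ grading i, ∀ g ∈ grading j, ∀ h ∈ grading k,
    gsign ((k + 1) * (j + 1)) (br h (br f g)) +
      gsign ((j + 1) * (i + 1)) (br g (br h f)) +
      gsign ((i + 1) * (k + 1)) (br f (br g h)) = 0
  δ₀ : A →ₗ[R] A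
  δ₀_deg : ∀ i : ℤ, ∀ f ∈ grading i, δ₀ f ∈ grading (i + 1)
  δ₀_sq : δ₀ ∘ₗ δ₀ = 0
  δ₀_der : ∀ i j : ℤ, ∀ f ∈ grading i, ∀ g ∈ grading j,
    δ₀ (br f g) = br (δ₀ f) g + gsign (i + 1) (br f (δ₀ g))

/-- A contraction of `(A, δ₀)` onto `(H, 0)`. -/
structure ContractionOntoH (𝒜 : OddGradedLieModule R A)
    (H : Type*) [AddCommGroup H] [Module R H] where
  grading : ℤ → Submodule R H
  internal : DirectSum.IsInternal grading
  ι : H →ₗ[R] A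
  p : A →ₗ[R] H
  h : A →ₗ[R] A
  ι_deg : ∀ i : ℤ, ∀ x ∈ grading i, ι x ∈ 𝒜.grading i
  p_deg : ∀ i : ℤ, ∀ x ∈ 𝒜.grading i, p x ∈ grading i
  h_deg : ∀ i : ℤ, ∀ x ∈ 𝒜.grading i, h x ∈ 𝒜.grading (i - 1)
  δ_ι : 𝒜.δ₀ ∘ₗ ι = 0
  p_δ : p ∘ₗ 𝒜.δ₀ = 0
  p_ι : p ∘ₗ ι = LinearMap.id
  homotopy : ι ∘ₗ p - LinearMap.id = h ∘ₗ 𝒜.δ₀ + 𝒜.δ₀ ∘ₗ h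
  h_h : h ∘ₗ h = 0
  h_ι : h ∘ₗ ι = 0
  p_h : p ∘ₗ h = 0

/-- The BRST operator `δ_BRST := p ∘ {S₁, ·} ∘ ι` on `H`. -/
def δBRST {𝒜 : OddGradedLieModule R A} (C : ContractionOntoH 𝒜 H) (S₁ : A) :
    H →ₗ[R] H :=
  C.p ∘ₗ 𝒜.br S₁ ∘ₗ C.ι


open Finset.HasAntidiagonal (antidiagonal mem_antidiagonal)

/-- A sum over triples `i + j + k = N` is invariant under rotating the summand. -/
lemma sum_antidiagonal_rotate {M : Type*} [AddCommMonoid M] (f : ℕ → ℕ → ℕ → M) (N : ℕ) :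
    ∑ x ∈ antidiagonal N, ∑ y ∈ antidiagonal x.2, f x.1 y.1 y.2 =
      ∑ x ∈ antidiagonal N, ∑ y ∈ antidiagonal x.2, f y.1 y.2 x.1 := by
  rw [Finset.sum_sigma', Finset.sum_sigma']
  refine Finset.sum_bij' (fun a _ => ⟨(a.2.2, a.1.1 + a.2.1), (a.1.1, a.2.1)⟩)
    (fun a _ => ⟨(a.2.1, a.2.2 + a.1.1), (a.2.2, a.1.1)⟩) ?_ ?_ ?_ ?_ ?_
  all_goals
    rintro ⟨⟨a, b⟩, ⟨c, d⟩⟩ hx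
    simp only [Finset.mem_sigma, mem_antidiagonal] at hx ⊢
  all_goals obtain ⟨rfl, rfl⟩ := hx
  · exact ⟨by omega, trivial⟩
  · exact ⟨by omega, trivial⟩
  all_goals rfl

namespace OddGradedLieModule

variable (𝒜 : OddGradedLieModule R A)

lemma br_mem_one {f g : A} (hf : f ∈ 𝒜.grading 0) (hg : g ∈ 𝒜.grading 0) :
    𝒜.br f g ∈ 𝒜.grading 1 := by
  simpa using 𝒜.br_deg 0 0 f hf g hg

lemma br_zero_one {f g : A} (hf : f ∈ 𝒜.grading 1) (hg : g ∈ 𝒜.grading 0) :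
    𝒜.br f g = -𝒜.br g f := by
  simpa [gsign] using 𝒜.br_comm 1 0 f hf g hg

lemma jacobi_zero {f g h : A} (hf : f ∈ 𝒜.grading 0) (hg : g ∈ 𝒜.grading 0)
    (hh : h ∈ 𝒜.grading 0) :
    𝒜.br f (𝒜.br g h) + 𝒜.br g (𝒜.br h f) + 𝒜.br h (𝒜.br f g) = 0 := by
  have := 𝒜.br_jacobi 0 0 0 f hf g hg h hh
  simp only [gsign, zero_add, mul_one, Int.not_even_one, if_false] at this
  rw [← neg_eq_zero, ← this]
  abel

lemma δ₀_br_zero {f g : A} (hf : f ∈ 𝒜.grading 0) (hg : g ∈ 𝒜.grading 0) :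
    𝒜.δ₀ (𝒜.br f g) = -(𝒜.br g (𝒜.δ₀ f) + 𝒜.br f (𝒜.δ₀ g)) := by
  have := 𝒜.δ₀_der 0 0 f hf g hg
  rw [𝒜.br_zero_one (f := 𝒜.δ₀ f) (by simpa using 𝒜.δ₀_deg 0 f hf) hg] at this
  simp only [gsign, zero_add, Int.not_even_one, if_false] at this
  rw [this]
  abel

/-- The self-convolution `Σ_{i+j=k} {s_i, s_j}` of a sequence. -/
def brConv (s : ℕ → A) (k : ℕ) : A :=
  ∑ x ∈ antidiagonal k, 𝒜.br (s x.1) (s x.2)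

variable {s : ℕ → A}

lemma brConv_mem (hs : ∀ k, s k ∈ 𝒜.grading 0) (k : ℕ) : 𝒜.brConv s k ∈ 𝒜.grading 1 :=
  Submodule.sum_mem _ fun _ _ => 𝒜.br_mem_one (hs _) (hs _)

/-- The Jacobi identity for a sequence of elements of degree `0`. As `3` need not be invertible,
it only holds after multiplication by `3`. -/
lemma three_smul_sum_br_brConv (hs : ∀ k, s k ∈ 𝒜.grading 0) (N : ℕ) :
    (3 : R) • ∑ x ∈ antidiagonal N, 𝒜.br (s x.1) (𝒜.brConv s x.2) = 0 := by
  have h₁ := sum_antidiagonal_rotate (fun i j k => 𝒜.br (s i) (𝒜.br (s j) (s k))) N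
  have h₂ := sum_antidiagonal_rotate (fun i j k => 𝒜.br (s j) (𝒜.br (s k) (s i))) N
  simp only [brConv, map_sum]
  rw [show (3 : R) = 1 + 1 + 1 by norm_num, add_smul, add_smul, one_smul]
  have h₃ : ∑ x ∈ antidiagonal N, ∑ y ∈ antidiagonal x.2,
      (𝒜.br (s x.1) (𝒜.br (s y.1) (s y.2)) + 𝒜.br (s y.1) (𝒜.br (s y.2) (s x.1)) +
        𝒜.br (s y.2) (𝒜.br (s x.1) (s y.1))) = 0 :=
    Finset.sum_eq_zero fun _ _ => Finset.sum_eq_zero fun _ _ =>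
      𝒜.jacobi_zero (hs _) (hs _) (hs _)
  simp only [Finset.sum_add_distrib] at h₃
  rwa [← h₂, ← h₁] at h₃

lemma δ₀_brConv (hs : ∀ k, s k ∈ 𝒜.grading 0) (N : ℕ) :
    𝒜.δ₀ (𝒜.brConv s N) =
      -((2 : R) • ∑ x ∈ antidiagonal N, 𝒜.br (s x.1) (𝒜.δ₀ (s x.2))) := by
  rw [two_smul]
  nth_rewrite 1 [← Finset.Nat.sum_antidiagonal_swap]
  rw [brConv, map_sum, ← Finset.sum_add_distrib, ← Finset.sum_neg_distrib]
  exact Finset.sum_congr rfl fun x _ => 𝒜.δ₀_br_zero (hs _) (hs _)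

end OddGradedLieModule

/-- If `s₁, …, s_n` solve the Maurer–Cartan equation up to order `n`, the obstruction at order
`n + 1` is BRST-closed up to multiplication by `3`. -/
lemma three_smul_δBRST_brConv {half : R} (hhalf : 2 * half = 1)
    {𝒜 : OddGradedLieModule R A} (C : ContractionOntoH 𝒜 H) {n : ℕ} {s : ℕ → A}
    (hs : ∀ k, s k ∈ 𝒜.grading 0) (hs_zero : s 0 = 0) (hs_large : ∀ k, n < k → s k = 0)
    (hds₁ : 𝒜.δ₀ (s 1) = 0) (hds : ∀ k ≤ n, 𝒜.δ₀ (s k) = -(half • 𝒜.brConv s k)) :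
    (3 : R) • δBRST C (s 1) (C.p (𝒜.brConv s (n + 1))) = 0 := by
  have key : ∀ k ≤ n, 𝒜.brConv s k = -((2 : R) • 𝒜.δ₀ (s k)) := fun k hk => by
    rw [hds k hk, smul_neg, neg_neg, smul_smul, hhalf, one_smul]
  have pδ : ∀ a, C.p (𝒜.δ₀ a) = 0 := fun a => LinearMap.congr_fun C.p_δ a
  have closed : (3 : R) • 𝒜.δ₀ (𝒜.brConv s (n + 1)) = 0 := by
    rw [← 𝒜.three_smul_sum_br_brConv hs (n + 1), 𝒜.δ₀_brConv hs, Finset.smul_sum,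
      ← Finset.sum_neg_distrib]
    refine congrArg _ (Finset.sum_congr rfl fun x hx => ?_)
    rw [mem_antidiagonal] at hx
    rcases Nat.eq_zero_or_pos x.1 with h0 | h0
    · simp [h0, hs_zero]
    · rw [key x.2 (by omega), map_neg, map_smul]
  have obstr : (3 : R) • C.p (𝒜.br (s 1) (𝒜.brConv s (n + 1))) = 0 := by
    have : ∑ x ∈ antidiagonal (n + 2), 𝒜.br (s x.1) (𝒜.brConv s x.2) =
        𝒜.br (s 1) (𝒜.brConv s (n + 1)) + 𝒜.δ₀ (𝒜.brConv s (n + 2)) := by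
      rw [𝒜.δ₀_brConv hs, Finset.Nat.sum_antidiagonal_succ, Finset.Nat.sum_antidiagonal_succ,
        Finset.Nat.sum_antidiagonal_succ, Finset.Nat.sum_antidiagonal_succ]
      simp only [hs_zero, map_zero, LinearMap.zero_apply, zero_add, hs_large (n + 1) (by omega),
        add_right_inj]
      rw [Finset.smul_sum, ← Finset.sum_neg_distrib]
      refine Finset.sum_congr rfl fun x hx => ?_
      rw [mem_antidiagonal] at hx
      rw [key x.2 (by omega), map_neg, map_smul]
    have h := congrArg C.p (𝒜.three_smul_sum_br_brConv hs (n + 2))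
    rwa [this, map_smul, map_add, pδ, add_zero, map_zero] at h
  have hmem : C.h (𝒜.brConv s (n + 1)) ∈ 𝒜.grading 0 := by
    simpa using C.h_deg 1 _ (𝒜.brConv_mem hs (n + 1))
  have hexact : C.p (𝒜.br (s 1) (𝒜.δ₀ (C.h (𝒜.brConv s (n + 1))))) = 0 := by
    have h := congrArg C.p (𝒜.δ₀_br_zero (hs 1) hmem)
    rwa [pδ, hds₁, map_zero, zero_add, map_neg, eq_comm, neg_eq_zero] at h
  have hιp : C.ι (C.p (𝒜.brConv s (n + 1))) = 𝒜.brConv s (n + 1) +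
      (C.h (𝒜.δ₀ (𝒜.brConv s (n + 1))) + 𝒜.δ₀ (C.h (𝒜.brConv s (n + 1)))) :=
    sub_eq_iff_eq_add'.mp (LinearMap.congr_fun C.homotopy (𝒜.brConv s (n + 1)))
  simp only [δBRST, LinearMap.comp_apply]
  rw [hιp, map_add, map_add, map_add, map_add, hexact, add_zero, smul_add, obstr, zero_add,
    ← map_smul, ← map_smul, ← map_smul, closed, map_zero, map_zero, map_zero]

/-- Let `S₂, …, S_n ∈ A₀` with `p S_k = 0`, and set
`T_k := (k!/2) Σ_{i+j=k, i,j≥1} {S_i, S_j}`. If `δ₀ S_k = −(1/k!) T_k` and `p T_k = 0` for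
`2 ≤ k ≤ n`, then `p T_{n+1}` is closed for the BRST operator: `δ_BRST (p T_{n+1}) = 0`. -/
theorem BRST_closed_pT (half : R) (hhalf : 2 * half = 1)
    (𝒜 : OddGradedLieModule R A) (C : ContractionOntoH 𝒜 H)
    (n : ℕ) (hn : 2 ≤ n)
    (S : ℕ → A)
    (hS₁mem : S 1 ∈ 𝒜.grading 0) (hdS₁ : 𝒜.δ₀ (S 1) = 0) (hhS₁ : C.h (S 1) = 0)
    (hexact : ∃ u : A, 𝒜.br (S 1) (S 1) = 𝒜.δ₀ u)
    (hSmem : ∀ k : ℕ, 2 ≤ k → k ≤ n → S k ∈ 𝒜.grading 0)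
    (hpS : ∀ k : ℕ, 2 ≤ k → k ≤ n → C.p (S k) = 0)
    (T : ℕ → A)
    (hT : ∀ k : ℕ, T k =
      (k.factorial : R) • half • ∑ i ∈ Finset.Ico 1 k, 𝒜.br (S i) (S (k - i)))
    -- `δ₀ S_k = −(1/k!) T_k`, i.e. `δ₀ S_k = −(1/2) Σ_{i+j=k, i,j≥1} {S_i, S_j}`:
    (hdS : ∀ k : ℕ, 2 ≤ k → k ≤ n →
      𝒜.δ₀ (S k) = -(half • ∑ i ∈ Finset.Ico 1 k, 𝒜.br (S i) (S (k - i))))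
    (hpT : ∀ k : ℕ, 2 ≤ k → k ≤ n → C.p (T k) = 0) :
    δBRST C (S 1) (C.p (T (n + 1))) = 0 := by
  set s : ℕ → A := fun k => if 1 ≤ k ∧ k ≤ n then S k else 0 with hs_def
  have s_eq : ∀ k, 1 ≤ k → k ≤ n → s k = S k := fun k h₁ h₂ => if_pos ⟨h₁, h₂⟩
  have s_zero : s 0 = 0 := if_neg (by omega)
  have s_large : ∀ k, n < k → s k = 0 := fun k hk => if_neg (by omega)
  have s_mem : ∀ k, s k ∈ 𝒜.grading 0 := fun k => by
    by_cases hk : 1 ≤ k ∧ k ≤ n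
    · rw [s_eq k hk.1 hk.2]
      rcases hk.1.eq_or_lt with rfl | h
      · exact hS₁mem
      · exact hSmem k h hk.2
    · rw [hs_def]
      simp only [if_neg hk, Submodule.zero_mem]
  have conv : ∀ k, k ≤ n + 1 →
      𝒜.brConv s k = ∑ i ∈ Finset.Ico 1 k, 𝒜.br (S i) (S (k - i)) := fun k hk => by
    rw [OddGradedLieModule.brConv,
      Finset.Nat.sum_antidiagonal_eq_sum_range_succ (fun i j => 𝒜.br (s i) (s j))]
    symm
    refine (Finset.sum_congr rfl fun i hi => ?_).trans
      (Finset.sum_subset (fun i hi => ?_) fun i hi hi' => ?_)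
    · rw [Finset.mem_Ico] at hi
      rw [s_eq i (by omega) (by omega), s_eq (k - i) (by omega) (by omega)]
    · rw [Finset.mem_Ico] at hi
      exact Finset.mem_range.mpr (by omega)
    · rw [Finset.mem_range] at hi
      rw [Finset.mem_Ico] at hi'
      rcases Nat.eq_zero_or_pos i with rfl | h
      · simp [s_zero]
      · simp [show k - i = 0 by omega, s_zero]
  have s_one : s 1 = S 1 := s_eq 1 le_rfl (by omega)
  have hds : ∀ k ≤ n, 𝒜.δ₀ (s k) = -(half • 𝒜.brConv s k) := fun k hk => by
    rw [conv k (by omega)]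
    match k, hk with
    | 0, _ => simp [s_zero]
    | 1, _ => simp [s_one, hdS₁]
    | k + 2, hk => rw [s_eq _ (by omega) hk, hdS _ (by omega) hk]
  have main := three_smul_δBRST_brConv hhalf C s_mem s_zero s_large
    (by rw [s_one, hdS₁]) hds
  obtain ⟨m, hm⟩ : 3 ∣ (n + 1).factorial := Nat.dvd_factorial (by omega) (by omega)
  rw [s_one] at main
  rw [hT, ← conv (n + 1) le_rfl, hm, Nat.cast_mul, Nat.cast_ofNat, mul_comm, mul_smul,
    smul_comm (3 : R) half]
  simp only [map_smul]
  rw [main, smul_zero, smul_zero]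

end BVBRST
end
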